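/- Let F* ∈ Ω, let G be the pushforward of F* under the map x ↦ s = 1/(1+x²) (so G is a probability measure on I_A = [1/(1+A²), 1]), and let q(y; G) = ∫ s·e^{−s·y} dG(s) (which equals p(y; F*)). If there exist λ₁ ≥ 0 and λ₂ ≥ 0 such that for all s ∈ I_A: λ₁·(1/s − 1 − P) − λ₂·(ℰ(√(1/s − 1)) − E_req) + I(F*) − log s + 1 + ∫₀^∞ s·e^{−s·y}·log q(y; G) dy ≥ 0, with equality for every s in the topological support of G, then F* is capacity-achieving, i.e., I(F*) = sup_{F ∈ Ω} I(F). -/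

import Mathlib

open MeasureTheory Real Set Filter

/-- Phase-removed Rayleigh-fading channel density `p(y|x)`. -/
noncomputable def pcond (x y : ℝ) : ℝ := (1 / (1 + x ^ 2)) * Real.exp (-y / (1 + x ^ 2))

/-- Modified Bessel function of the first kind, order zero. -/
noncomputable def besselI0 (t : ℝ) : ℝ := ∑' n : ℕ, (t ^ 2 / 4) ^ n / ((Nat.factorial n : ℝ)) ^ 2

/-- Harvested-energy function `ℰ(x) = I₀(√2 B h₂ x)`. -/
noncomputable def EH (B h2 x : ℝ) : ℝ := besselI0 (Real.sqrt 2 * B * h2 * x)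

/-- Output density `p(y; F)`. -/
noncomputable def pout (F : Measure ℝ) (y : ℝ) : ℝ := ∫ x, pcond x y ∂F

/-- Mutual-information density `i(x; F)`. -/
noncomputable def idens (F : Measure ℝ) (x : ℝ) : ℝ :=
  ∫ y in Set.Ioi (0 : ℝ), pcond x y * Real.log (pcond x y / pout F y)

/-- Mutual information `I(F)`. -/
noncomputable def MI (F : Measure ℝ) : ℝ := ∫ x, idens F x ∂F

/-- Borel probability measure concentrated on `[0, A]`. -/
def IsDistOn (A : ℝ) (F : Measure ℝ) : Prop :=
  IsProbabilityMeasure F ∧ F (Set.Icc 0 A)ᶜ = 0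

/-- The feasible set `Ω`: probability measures on `[0,A]` meeting the AP and EH constraints. -/
def Feas (A P B h2 Ereq : ℝ) (F : Measure ℝ) : Prop :=
  IsDistOn A F ∧ (∫ x, x ^ 2 ∂F) ≤ P ∧ Ereq ≤ ∫ x, EH B h2 x ∂F

/-- Information-energy capacity `C = sup_{F ∈ Ω} I(F)`. -/
noncomputable def Cap (A P B h2 Ereq : ℝ) : ℝ :=
  sSup (MI '' {F | Feas A P B h2 Ereq F})

/-- Topological support of a measure: points all of whose open neighborhoods have
positive measure (the smallest closed set of full measure). -/
def msupp {X : Type*} [TopologicalSpace X] [MeasurableSpace X] (μ : Measure X) : Set X :=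
  {x | ∀ U : Set X, IsOpen U → x ∈ U → 0 < μ U}

/-- Output density in the `s`-domain: `q(y; G) = ∫ s·e^{−s·y} dG(s)`. -/
noncomputable def qout (G : Measure ℝ) (y : ℝ) : ℝ := ∫ s, s * Real.exp (-s * y) ∂G

lemma pcond_eq (x y : ℝ) :
    pcond x y = (1 / (1 + x ^ 2)) * Real.exp (-(1 / (1 + x ^ 2)) * y) := by
  unfold pcond
  congr 2
  ring

lemma pcond_pos (x y : ℝ) : 0 < pcond x y := by
  unfold pcond
  positivity

lemma continuous_pcond : Continuous fun z : ℝ × ℝ => pcond z.1 z.2 := by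
  unfold pcond
  have h : ∀ z : ℝ × ℝ, 1 + z.1 ^ 2 ≠ 0 := fun z => by positivity
  fun_prop (disch := assumption)

lemma inv_one_add_sq_mem {A x : ℝ} (hx : x ∈ Icc 0 A) :
    1 / (1 + x ^ 2) ∈ Icc (1 / (1 + A ^ 2)) (1 : ℝ) := by
  obtain ⟨h0, hA⟩ := hx
  constructor
  · gcongr
  · rw [div_le_one (by positivity)]
    nlinarith [sq_nonneg x]

lemma pcond_le {A x y : ℝ} (hx : x ∈ Icc 0 A) (hy : 0 ≤ y) :
    pcond x y ≤ Real.exp (-(1 / (1 + A ^ 2)) * y) := by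
  obtain ⟨h1, h2⟩ := inv_one_add_sq_mem hx
  rw [pcond_eq]
  calc _ ≤ 1 * Real.exp (-(1 / (1 + x ^ 2)) * y) := by gcongr
    _ ≤ _ := by
      rw [one_mul]
      gcongr

lemma le_pcond {A x y : ℝ} (hx : x ∈ Icc 0 A) (hy : 0 ≤ y) :
    1 / (1 + A ^ 2) * Real.exp (-y) ≤ pcond x y := by
  obtain ⟨h1, h2⟩ := inv_one_add_sq_mem hx
  rw [pcond_eq]
  gcongr
  nlinarith

lemma IsDistOn.ae_mem {A : ℝ} {F : Measure ℝ} (hF : IsDistOn A F) : ∀ᵐ x ∂F, x ∈ Icc 0 A :=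
  mem_ae_iff.mpr hF.2

lemma IsDistOn.integrable_pcond {A : ℝ} {F : Measure ℝ} (hF : IsDistOn A F) {y : ℝ}
    (hy : 0 ≤ y) : Integrable (fun x => pcond x y) F := by
  have := hF.1
  refine Integrable.of_bound (C := Real.exp (-(1 / (1 + A ^ 2)) * y)) ?_ ?_
  · exact (continuous_pcond.comp (by fun_prop : Continuous fun x : ℝ => (x, y))).aestronglyMeasurable
  · filter_upwards [hF.ae_mem] with x hx
    rw [Real.norm_of_nonneg (pcond_pos x y).le]
    exact pcond_le hx hy

lemma IsDistOn.le_pout {A : ℝ} {F : Measure ℝ} (hF : IsDistOn A F) {y : ℝ} (hy : 0 ≤ y) :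
    1 / (1 + A ^ 2) * Real.exp (-y) ≤ pout F y := by
  have := hF.1
  have h := integral_mono_ae (μ := F) (integrable_const (1 / (1 + A ^ 2) * Real.exp (-y)))
    (hF.integrable_pcond hy) (by filter_upwards [hF.ae_mem] with x hx using le_pcond hx hy)
  simpa [pout] using h

lemma IsDistOn.pout_le_one {A : ℝ} {F : Measure ℝ} (hF : IsDistOn A F) {y : ℝ} (hy : 0 ≤ y) :
    pout F y ≤ 1 := by
  have := hF.1
  have h := integral_mono_ae (μ := F) (hF.integrable_pcond hy) (integrable_const 1) (by
    filter_upwards [hF.ae_mem] with x hx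
    refine (pcond_le hx hy).trans (Real.exp_le_one_iff.mpr ?_)
    have : 0 ≤ 1 / (1 + A ^ 2) * y := by positivity
    linarith)
  simpa [pout] using h

lemma IsDistOn.pout_pos {A : ℝ} {F : Measure ℝ} (hF : IsDistOn A F) {y : ℝ} (hy : 0 ≤ y) :
    0 < pout F y :=
  lt_of_lt_of_le (by positivity) (hF.le_pout hy)

lemma IsDistOn.abs_log_pout_le {A : ℝ} {F : Measure ℝ} (hF : IsDistOn A F) {y : ℝ}
    (hy : 0 ≤ y) : |Real.log (pout F y)| ≤ Real.log (1 + A ^ 2) + y := by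
  have h1 := Real.log_le_log (by positivity) (hF.le_pout hy)
  have h2 := Real.log_nonpos (hF.pout_pos hy).le (hF.pout_le_one hy)
  rw [Real.log_mul (by positivity) (by positivity), Real.log_exp, one_div, Real.log_inv] at h1
  rw [abs_of_nonpos h2]
  linarith

lemma IsDistOn.measurable_pout {A : ℝ} {F : Measure ℝ} (hF : IsDistOn A F) :
    Measurable (pout F) := by
  have := hF.1
  exact (continuous_pcond.stronglyMeasurable.integral_prod_left' (μ := F)).measurable

lemma integrableOn_exp_neg_mul {s : ℝ} (hs : 0 < s) :
    IntegrableOn (fun y => Real.exp (-s * y)) (Ioi 0) :=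
  integrableOn_exp_mul_Ioi (by linarith) 0

lemma integrableOn_mul_exp_neg_mul {s : ℝ} (hs : 0 < s) :
    IntegrableOn (fun y => y * Real.exp (-s * y)) (Ioi 0) := by
  have h := integrableOn_rpow_mul_exp_neg_mul_rpow (s := 1) (p := 1) (b := s) (by norm_num)
    one_pos hs
  simpa using h

lemma integral_exp_neg_mul {s : ℝ} (hs : 0 < s) :
    ∫ y in Ioi (0 : ℝ), Real.exp (-s * y) = 1 / s := by
  rw [integral_exp_mul_Ioi (by linarith)]
  simp

lemma integral_mul_exp_neg_mul {s : ℝ} (hs : 0 < s) :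
    ∫ y in Ioi (0 : ℝ), y * Real.exp (-s * y) = 1 / s ^ 2 := by
  have h := Real.integral_rpow_mul_exp_neg_mul_Ioi (a := 2) (r := s) (by norm_num) hs
  have h2 : Real.Gamma 2 = 1 := by simp
  rw [h2] at h
  norm_num at h
  simpa using h

lemma integrable_majorant (A : ℝ) : IntegrableOn
    (fun y => Real.exp (-(1 / (1 + A ^ 2)) * y) * (Real.log (1 + A ^ 2) + y)) (Ioi 0) := by
  have hs : 0 < 1 / (1 + A ^ 2) := by positivity
  refine (((integrableOn_exp_neg_mul hs).mul_const (Real.log (1 + A ^ 2))).add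
    (integrableOn_mul_exp_neg_mul hs)).congr (Eventually.of_forall fun y => ?_)
  simp only [Pi.add_apply]
  ring

/-- The cross term `p(y|x) log p(y; F')` is integrable in `y`. -/
lemma IsDistOn.integrableOn_pcond_mul_log {A : ℝ} {F' : Measure ℝ} (hF' : IsDistOn A F') {x : ℝ}
    (hx : x ∈ Icc 0 A) :
    IntegrableOn (fun y => pcond x y * Real.log (pout F' y)) (Ioi 0) := by
  refine Integrable.mono' (integrable_majorant A) ?_ ?_
  · exact ((continuous_pcond.comp (by fun_prop : Continuous fun y : ℝ => (x, y))).measurable.mul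
      (Real.measurable_log.comp hF'.measurable_pout)).aestronglyMeasurable
  · filter_upwards [ae_restrict_mem measurableSet_Ioi] with y hy
    rw [norm_mul, Real.norm_of_nonneg (pcond_pos x y).le]
    exact mul_le_mul (pcond_le hx (le_of_lt hy)) (hF'.abs_log_pout_le (le_of_lt hy))
      (abs_nonneg _) (Real.exp_pos _).le

lemma ae_prod_mem {A : ℝ} {F : Measure ℝ} (hF : IsDistOn A F) :
    ∀ᵐ z ∂(F.prod (volume.restrict (Ioi (0 : ℝ)))), z.1 ∈ Icc 0 A ∧ 0 < z.2 := by
  have := hF.1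
  have h1 := Measure.quasiMeasurePreserving_fst (μ := F) (ν := volume.restrict (Ioi (0 : ℝ)))
    |>.ae hF.ae_mem
  have h2 := Measure.quasiMeasurePreserving_snd (μ := F) (ν := volume.restrict (Ioi (0 : ℝ)))
    |>.ae (ae_restrict_mem measurableSet_Ioi)
  filter_upwards [h1, h2] with z hz1 hz2 using ⟨hz1, hz2⟩

lemma IsDistOn.integrable_prod_log {A : ℝ} {F F' : Measure ℝ} (hF : IsDistOn A F)
    (hF' : IsDistOn A F') :
    Integrable (fun z : ℝ × ℝ => pcond z.1 z.2 * Real.log (pout F' z.2))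
      (F.prod (volume.restrict (Ioi 0))) := by
  have := hF.1
  refine Integrable.mono' ((integrable_majorant A).comp_snd F) ?_ ?_
  · exact (continuous_pcond.measurable.mul
      (Real.measurable_log.comp (hF'.measurable_pout.comp measurable_snd))).aestronglyMeasurable
  · filter_upwards [ae_prod_mem hF] with z ⟨hx, hy⟩
    rw [norm_mul, Real.norm_of_nonneg (pcond_pos _ _).le]
    exact mul_le_mul (pcond_le hx hy.le) (hF'.abs_log_pout_le hy.le)
      (abs_nonneg _) (Real.exp_pos _).le

lemma IsDistOn.integrable_prod_pcond {A : ℝ} {F : Measure ℝ} (hF : IsDistOn A F) :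
    Integrable (fun z : ℝ × ℝ => pcond z.1 z.2) (F.prod (volume.restrict (Ioi 0))) := by
  have := hF.1
  refine Integrable.mono' ((integrableOn_exp_neg_mul
    (by positivity : 0 < 1 / (1 + A ^ 2))).comp_snd F) continuous_pcond.aestronglyMeasurable ?_
  filter_upwards [ae_prod_mem hF] with z ⟨hx, hy⟩
  rw [Real.norm_of_nonneg (pcond_pos _ _).le]
  exact pcond_le hx hy.le

lemma integral_pcond (x : ℝ) : ∫ y in Ioi (0 : ℝ), pcond x y = 1 := by
  have hs : 0 < 1 / (1 + x ^ 2) := by positivity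
  simp_rw [pcond_eq]
  rw [integral_const_mul, integral_exp_neg_mul hs]
  field_simp

lemma IsDistOn.integrableOn_pout {A : ℝ} {F : Measure ℝ} (hF : IsDistOn A F) :
    IntegrableOn (pout F) (Ioi 0) := by
  have := hF.1
  exact hF.integrable_prod_pcond.integral_prod_right

lemma IsDistOn.integral_pout {A : ℝ} {F : Measure ℝ} (hF : IsDistOn A F) :
    ∫ y in Ioi (0 : ℝ), pout F y = 1 := by
  have := hF.1
  unfold pout
  rw [← integral_integral_swap hF.integrable_prod_pcond]
  simp [integral_pcond]

/-- Splitting `i(x; F)` into the negative conditional entropy and the cross term. -/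
lemma IsDistOn.idens_eq {A : ℝ} {F : Measure ℝ} (hF : IsDistOn A F) {x : ℝ}
    (hx : x ∈ Icc 0 A) :
    idens F x = Real.log (1 / (1 + x ^ 2)) - 1
      - ∫ y in Ioi (0 : ℝ), pcond x y * Real.log (pout F y) := by
  have hs : 0 < 1 / (1 + x ^ 2) := by positivity
  set s := 1 / (1 + x ^ 2) with hs_def
  have hsplit : ∀ y ∈ Ioi (0 : ℝ), pcond x y * Real.log (pcond x y / pout F y) =
      (s * Real.log s * Real.exp (-s * y) - s ^ 2 * (y * Real.exp (-s * y)))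
        - pcond x y * Real.log (pout F y) := by
    intro y hy
    rw [Real.log_div (pcond_pos x y).ne' (hF.pout_pos (le_of_lt hy)).ne', mul_sub]
    congr 1
    rw [pcond_eq, ← hs_def, Real.log_mul hs.ne' (Real.exp_pos _).ne', Real.log_exp]
    ring
  unfold idens
  have i1 := (integrableOn_exp_neg_mul hs).const_mul (s * Real.log s)
  have i2 := (integrableOn_mul_exp_neg_mul hs).const_mul (s ^ 2)
  have i12 : Integrable (fun y => s * Real.log s * Real.exp (-s * y)
      - s ^ 2 * (y * Real.exp (-s * y))) (volume.restrict (Ioi 0)) := i1.sub i2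
  rw [setIntegral_congr_fun measurableSet_Ioi hsplit,
    integral_sub i12 (hF.integrableOn_pcond_mul_log hx), integral_sub i1 i2,
    integral_const_mul, integral_const_mul, integral_exp_neg_mul hs, integral_mul_exp_neg_mul hs]
  congr 1
  field_simp

lemma IsDistOn.integrable_log {A : ℝ} {F : Measure ℝ} (hF : IsDistOn A F) :
    Integrable (fun x => Real.log (1 / (1 + x ^ 2)) - 1) F := by
  have := hF.1
  have hc : Continuous fun x : ℝ => Real.log (1 / (1 + x ^ 2)) - 1 := by
    have h : ∀ x : ℝ, 1 + x ^ 2 ≠ 0 := fun x => by positivity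
    have h' : ∀ x : ℝ, 1 / (1 + x ^ 2) ≠ 0 := fun x => by positivity
    fun_prop (disch := assumption)
  rw [← integrableOn_univ, ← integrableOn_congr_set_ae (eventuallyEq_univ.mpr hF.ae_mem)]
  exact hc.integrableOn_Icc

lemma IsDistOn.integrable_idens {A : ℝ} {F F' : Measure ℝ} (hF : IsDistOn A F)
    (hF' : IsDistOn A F') : Integrable (idens F') F := by
  have := hF.1
  refine (hF.integrable_log.sub (hF.integrable_prod_log hF').integral_prod_left).congr ?_
  filter_upwards [hF.ae_mem] with x hx
  rw [hF'.idens_eq hx]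
  rfl

/-- Gibbs' inequality for output densities. -/
lemma IsDistOn.integral_cross_le {A : ℝ} {F F' : Measure ℝ} (hF : IsDistOn A F)
    (hF' : IsDistOn A F') :
    ∫ x, (∫ y in Ioi (0 : ℝ), pcond x y * Real.log (pout F' y)) ∂F ≤
      ∫ x, (∫ y in Ioi (0 : ℝ), pcond x y * Real.log (pout F y)) ∂F := by
  have := hF.1
  have hint : ∀ {F'' : Measure ℝ}, IsDistOn A F'' →
      IntegrableOn (fun y => pout F y * Real.log (pout F'' y)) (Ioi 0) := by
    intro F'' h
    refine (hF.integrable_prod_log h).integral_prod_right.congr (Eventually.of_forall fun y => ?_)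
    exact integral_mul_const (Real.log (pout F'' y)) fun x => pcond x y
  have hswap : ∀ {F'' : Measure ℝ}, IsDistOn A F'' →
      ∫ x, (∫ y in Ioi (0 : ℝ), pcond x y * Real.log (pout F'' y)) ∂F =
        ∫ y in Ioi (0 : ℝ), pout F y * Real.log (pout F'' y) := by
    intro F'' h
    rw [integral_integral_swap (hF.integrable_prod_log h)]
    simp_rw [integral_mul_const]
    rfl
  rw [hswap hF', hswap hF]
  have hmono := setIntegral_mono_on ((hint hF').sub (hint hF))
    (hF'.integrableOn_pout.sub hF.integrableOn_pout) measurableSet_Ioi (by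
      intro y hy
      have h1 := hF.pout_pos (le_of_lt hy)
      have h2 := hF'.pout_pos (le_of_lt hy)
      have h3 := Real.log_le_sub_one_of_pos (div_pos h2 h1)
      rw [Real.log_div h2.ne' h1.ne'] at h3
      have h4 := mul_le_mul_of_nonneg_left h3 h1.le
      have h5 : pout F y * (pout F' y / pout F y - 1) = pout F' y - pout F y := by
        field_simp
      simp only [Pi.sub_apply]
      linarith)
  simp only [Pi.sub_apply] at hmono
  rw [integral_sub (hint hF') (hint hF), integral_sub hF'.integrableOn_pout hF.integrableOn_pout,
    hF.integral_pout, hF'.integral_pout] at hmono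
  linarith

/-- Replacing the output density by that of any other input can only increase the averaged
information density. -/
lemma IsDistOn.MI_le_integral_idens {A : ℝ} {F F' : Measure ℝ} (hF : IsDistOn A F)
    (hF' : IsDistOn A F') : MI F ≤ ∫ x, idens F' x ∂F := by
  have := hF.1
  have h : ∀ {F'' : Measure ℝ}, IsDistOn A F'' → ∫ x, idens F'' x ∂F =
      ∫ x, (Real.log (1 / (1 + x ^ 2)) - 1) ∂F -
        ∫ x, (∫ y in Ioi (0 : ℝ), pcond x y * Real.log (pout F'' y)) ∂F := by
    intro F'' hF''
    rw [← integral_sub hF.integrable_log (hF.integrable_prod_log hF'').integral_prod_left]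
    refine integral_congr_ae ?_
    filter_upwards [hF.ae_mem] with x hx using hF''.idens_eq hx
  unfold MI
  rw [h hF, h hF']
  linarith [hF.integral_cross_le hF']

lemma summable_besselI0 (t : ℝ) :
    Summable fun n : ℕ => (t ^ 2 / 4) ^ n / ((Nat.factorial n : ℝ)) ^ 2 := by
  refine Summable.of_nonneg_of_le (fun n => by positivity) (fun n => ?_)
    (Real.summable_pow_div_factorial (t ^ 2 / 4))
  have h : (1 : ℝ) ≤ Nat.factorial n := by
    exact_mod_cast Nat.one_le_iff_ne_zero.mpr n.factorial_ne_zero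
  gcongr
  nlinarith

lemma besselI0_monotoneOn : MonotoneOn besselI0 (Ici 0) := by
  intro a ha b _ hab
  have ha : 0 ≤ a := ha
  refine (summable_besselI0 a).tsum_le_tsum (fun n => ?_) (summable_besselI0 b)
  gcongr

lemma IsDistOn.integrable_EH {A B h2 : ℝ} (hB : 0 < B) (hh2 : 0 < h2) {F : Measure ℝ}
    (hF : IsDistOn A F) : Integrable (EH B h2) F := by
  have := hF.1
  rw [← integrableOn_univ, ← integrableOn_congr_set_ae (eventuallyEq_univ.mpr hF.ae_mem)]
  refine MonotoneOn.integrableOn_isCompact isCompact_Icc fun a ha b hb hab => ?_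
  refine besselI0_monotoneOn ?_ ?_ (by gcongr)
  · have := ha.1
    simp only [mem_Ici]
    positivity
  · have := hb.1
    simp only [mem_Ici]
    positivity

lemma IsDistOn.integrable_sq {A : ℝ} {F : Measure ℝ} (hF : IsDistOn A F) :
    Integrable (fun x => x ^ 2) F := by
  have := hF.1
  rw [← integrableOn_univ, ← integrableOn_congr_set_ae (eventuallyEq_univ.mpr hF.ae_mem)]
  exact (continuous_pow 2).integrableOn_Icc

lemma qout_map (F : Measure ℝ) (y : ℝ) :
    qout (Measure.map (fun x : ℝ => 1 / (1 + x ^ 2)) F) y = pout F y := by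
  unfold qout pout
  rw [integral_map (by fun_prop) (by fun_prop)]
  simp_rw [pcond_eq]

/-- `s`-domain sufficient condition: let `F* ∈ Ω` and let `G` be the
pushforward of `F*` under `x ↦ 1/(1+x²)` (a probability measure on
`I_A = [1/(1+A²), 1]`). If there exist `λ₁, λ₂ ≥ 0` with, for all `s ∈ I_A`,
`λ₁(1/s − 1 − P) − λ₂(ℰ(√(1/s − 1)) − E_req) + I(F*) − log s + 1 +
∫₀^∞ s e^{−sy} log q(y;G) dy ≥ 0`, with equality on the topological support of `G`,
then `F*` is capacity-achieving. -/
theorem stmt4 (A P B h2 Ereq : ℝ) (hA : 0 < A) (hP : 0 < P) (hB : 0 < B) (hh2 : 0 < h2)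
    (Fstar : Measure ℝ) (hFstar : Feas A P B h2 Ereq Fstar)
    (G : Measure ℝ) (hG : G = Measure.map (fun x : ℝ => 1 / (1 + x ^ 2)) Fstar)
    (l1 l2 : ℝ) (hl1 : 0 ≤ l1) (hl2 : 0 ≤ l2)
    (hineq : ∀ s ∈ Set.Icc (1 / (1 + A ^ 2)) (1 : ℝ),
      0 ≤ l1 * (1 / s - 1 - P) - l2 * (EH B h2 (Real.sqrt (1 / s - 1)) - Ereq)
          + MI Fstar - Real.log s + 1
          + ∫ y in Set.Ioi (0 : ℝ), s * Real.exp (-s * y) * Real.log (qout G y))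
    (heq : ∀ s ∈ msupp G,
      l1 * (1 / s - 1 - P) - l2 * (EH B h2 (Real.sqrt (1 / s - 1)) - Ereq)
          + MI Fstar - Real.log s + 1
          + (∫ y in Set.Ioi (0 : ℝ), s * Real.exp (-s * y) * Real.log (qout G y)) = 0) :
    MI Fstar = Cap A P B h2 Ereq := by
  have hS := hFstar.1
  have hkey : ∀ x ∈ Icc 0 A, idens Fstar x ≤
      l1 * (x ^ 2 - P) - l2 * (EH B h2 x - Ereq) + MI Fstar := by
    intro x hx
    have h := hineq _ (inv_one_add_sq_mem hx)
    have hinv : 1 / (1 / (1 + x ^ 2)) - 1 = x ^ 2 := by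
      rw [one_div_one_div]
      ring
    rw [hinv, Real.sqrt_sq hx.1] at h
    simp_rw [hG, qout_map, ← pcond_eq] at h
    rw [hS.idens_eq hx]
    linarith
  have hgreatest : IsGreatest (MI '' {F | Feas A P B h2 Ereq F}) (MI Fstar) := by
    refine ⟨⟨Fstar, hFstar, rfl⟩, ?_⟩
    rintro _ ⟨F, ⟨hF, hFP, hFE⟩, rfl⟩
    have := hF.1
    have i1 : Integrable (fun x => l1 * (x ^ 2 - P)) F :=
      (hF.integrable_sq.sub (integrable_const P)).const_mul l1
    have i2 : Integrable (fun x => l2 * (EH B h2 x - Ereq)) F :=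
      ((hF.integrable_EH hB hh2).sub (integrable_const Ereq)).const_mul l2
    have i12 : Integrable (fun x => l1 * (x ^ 2 - P) - l2 * (EH B h2 x - Ereq)) F := i1.sub i2
    have h := integral_mono_ae (hF.integrable_idens hS)
      (i12.add (integrable_const (MI Fstar)))
      (by filter_upwards [hF.ae_mem] with x hx using hkey x hx)
    simp only [Pi.add_apply] at h
    rw [integral_add i12 (integrable_const _), integral_sub i1 i2, integral_const_mul,
      integral_const_mul, integral_sub hF.integrable_sq (integrable_const _),
      integral_sub (hF.integrable_EH hB hh2) (integrable_const _)] at h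
    simp only [integral_const, probReal_univ, one_smul] at h
    have h1 := mul_nonneg hl1 (sub_nonneg.mpr hFP)
    have h2' := mul_nonneg hl2 (sub_nonneg.mpr hFE)
    linarith [hF.MI_le_integral_idens hS]
  exact hgreatest.csSup_eq.symm
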